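/- arXiv:1908.11455 — 2 statements merged into one kernel-verified Lean document; each statement's English description precedes it below -/
import Mathlib

section
/- For any partition λ and any permutation w ∈ S_∞, the standardization map std is an injection from the set of Edelman–Greene tableaux of type (λ, w) into the set of standard Young tableaux of shape λ. -/
open Equiv

/-- The simple transposition `sᵢ = (i, i+1)` in `S_∞` (realized as `Equiv.Perm ℕ`). -/
def EGs (i : ℕ) : Equiv.Perm ℕ := Equiv.swap i (i + 1)

/-- Coxeter length: the minimal length of a word in the simple transpositions for `w`. -/
noncomputable def coxLength (w : Equiv.Perm ℕ) : ℕ :=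
  sInf {k | ∃ l : List ℕ, (l.map EGs).prod = w ∧ l.length = k}

/-- `l` is a reduced word for `w`. -/
def IsReducedWord (w : Equiv.Perm ℕ) (l : List ℕ) : Prop :=
  (l.map EGs).prod = w ∧ l.length = coxLength w

/-- Top-to-bottom, right-to-left reading word of a filling of `μ`. -/
def readingWord (μ : YoungDiagram) (T : ℕ → ℕ → ℕ) : List ℕ :=
  (List.range (μ.colLen 0)).flatMap fun i =>
    ((List.range (μ.rowLen i)).reverse).map fun j => T i j

/-- Standard Young tableaux of shape `μ`, as entry functions: strictly increasing along
rows and columns, zero outside `μ`, and the labels on the cells are exactly `1,…,|μ|`. -/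
def SYTset (μ : YoungDiagram) : Set (ℕ → ℕ → ℕ) :=
  {T | (∀ i j1 j2, j1 < j2 → (i, j2) ∈ μ.cells → T i j1 < T i j2) ∧
       (∀ i1 i2 j, i1 < i2 → (i2, j) ∈ μ.cells → T i1 j < T i2 j) ∧
       (∀ i j, (i, j) ∉ μ.cells → T i j = 0) ∧
       μ.cells.image (fun c => T c.1 c.2) = Finset.Icc 1 μ.card}

/-- Edelman–Greene tableaux of type `(μ, w)`, as entry functions: strictly increasing
along rows and columns, zero outside `μ`, whose reading word is a reduced word of `w`. -/
def EGset (μ : YoungDiagram) (w : Equiv.Perm ℕ) : Set (ℕ → ℕ → ℕ) :=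
  {T | (∀ i j1 j2, j1 < j2 → (i, j2) ∈ μ.cells → T i j1 < T i j2) ∧
       (∀ i1 i2 j, i1 < i2 → (i2, j) ∈ μ.cells → T i1 j < T i2 j) ∧
       (∀ i j, (i, j) ∉ μ.cells → T i j = 0) ∧
       IsReducedWord w (readingWord μ T)}

/-- Standardization: the cell `(i,j)` receives the rank of its entry, where equal
entries are ordered left to right (by column). -/
def stdEntry (μ : YoungDiagram) (T : ℕ → ℕ → ℕ) (i j : ℕ) : ℕ :=
  if (i, j) ∈ μ.cells then
    (μ.cells.filter fun c =>
      T c.1 c.2 < T i j ∨ (T c.1 c.2 = T i j ∧ c.2 < j) ∨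
        (T c.1 c.2 = T i j ∧ c.2 = j ∧ c.1 ≤ i)).card
  else 0

/-- `k` is a descent of the standard tableau `U`: the cell labeled `k - 1` lies weakly
east of the cell labeled `k`. -/
def IsDescent (μ : YoungDiagram) (U : ℕ → ℕ → ℕ) (k : ℕ) : Prop :=
  ∃ c ∈ μ.cells, ∃ c' ∈ μ.cells, U c.1 c.2 = k ∧ U c'.1 c'.2 = k - 1 ∧ c.2 ≤ c'.2

open scoped Classical in
/-- The sweep map: a cell's entry is one plus the number of descents of `U` that are
at most its label in `U`. -/
noncomputable def sweepEntry (μ : YoungDiagram) (U : ℕ → ℕ → ℕ) (i j : ℕ) : ℕ :=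
  if (i, j) ∈ μ.cells then
    ((Finset.Icc 1 (U i j)).filter fun k => IsDescent μ U k).card + 1
  else 0

/-- `w` is totally commutative: it has a reduced word whose letters are pairwise
at distance at least `2`. -/
def TotallyCommutative (w : Equiv.Perm ℕ) : Prop :=
  ∃ l : List ℕ, IsReducedWord w l ∧ l.Pairwise fun a b => 2 ≤ Nat.dist a b

namespace EGProof

/-! ### Words as functions of time, with a set `D` of active times -/

/-- State (contents by position) at time `t`. -/
def st (D : Set ℕ) [DecidablePred (· ∈ D)] (a : ℕ → ℕ) (u : ℕ → ℕ) : ℕ → ℕ → ℕ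
  | 0 => u
  | t + 1 => if t ∈ D then fun j => st D a u t (Equiv.swap (a t) (a t + 1) j) else st D a u t

/-- Position of the smallest wire at time `t`. -/
def pos (D : Set ℕ) [DecidablePred (· ∈ D)] (a : ℕ → ℕ) : ℕ → ℕ
  | 0 => 0
  | t + 1 => if t ∈ D ∧ a t = pos D a t then pos D a t + 1 else pos D a t

def skip (q j : ℕ) : ℕ := if j < q then j else j + 1

/-- The word after deletion of the smallest wire. -/
def del (D : Set ℕ) [DecidablePred (· ∈ D)] (a : ℕ → ℕ) (t : ℕ) : ℕ :=
  if a t < pos D a t then a t else a t - 1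

def Good (D : Set ℕ) [DecidablePred (· ∈ D)] (a : ℕ → ℕ) (u : ℕ → ℕ) : Prop :=
  ∀ t ∈ D, st D a u t (a t) < st D a u t (a t + 1)

section
variable (D : Set ℕ) [DecidablePred (· ∈ D)] (a : ℕ → ℕ) (u : ℕ → ℕ)

theorem pos_succ_hit {t : ℕ} (h : t ∈ D) (h2 : a t = pos D a t) :
    pos D a (t + 1) = pos D a t + 1 := by
  simp [pos, h, h2]

theorem pos_mono : Monotone (pos D a) := by
  apply monotone_nat_of_le_succ
  intro t
  simp only [pos]
  split_ifs <;> omega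

theorem wire (hu : ∀ j, j ≠ 0 → u 0 < u j) (hg : Good D a u) (t : ℕ) :
    st D a u t (pos D a t) = u 0 ∧ ∀ j, j ≠ pos D a t → u 0 < st D a u t j := by
  induction t with
  | zero => exact ⟨rfl, hu⟩
  | succ t ih =>
    obtain ⟨h1, h2⟩ := ih
    by_cases hD : t ∈ D
    · have hgt := hg t hD
      have hne : a t + 1 ≠ pos D a t := by
        intro h
        rw [h, h1] at hgt
        have := h2 (a t) (by omega)
        omega
      by_cases hq : a t = pos D a t
      · simp only [st, pos, hD, hq, if_true, true_and]
        refine ⟨by simpa using h1, ?_⟩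
        intro j hj
        apply h2
        rw [Equiv.swap_apply_def]
        split_ifs <;> omega
      · simp only [st, pos, hD, hq, if_true, and_false, if_false]
        refine ⟨?_, ?_⟩
        · rw [Equiv.swap_apply_of_ne_of_ne (by omega) (by omega)]
          exact h1
        · intro j hj
          apply h2
          rw [Equiv.swap_apply_def]
          split_ifs <;> omega
    · simp only [st, pos, hD, if_false, false_and]
      exact ⟨h1, h2⟩

theorem ne_pos (hu : ∀ j, j ≠ 0 → u 0 < u j) (hg : Good D a u) {t : ℕ} (hD : t ∈ D) :
    a t + 1 ≠ pos D a t := by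
  intro h
  obtain ⟨h1, h2⟩ := wire D a u hu hg t
  have hgt := hg t hD
  rw [h, h1] at hgt
  have := h2 (a t) (by omega)
  omega

theorem exists_before {s c : ℕ} (h : c < pos D a s) :
    ∃ t, t < s ∧ t ∈ D ∧ pos D a t = c ∧ a t = c := by
  induction s with
  | zero => simp [pos] at h
  | succ s ih =>
    by_cases hs : c < pos D a s
    · obtain ⟨t, ht, h'⟩ := ih hs
      exact ⟨t, by omega, h'⟩
    · simp only [pos] at h
      split_ifs at h with hc
      · exact ⟨s, by omega, hc.1, by omega, by omega⟩
      · omega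

theorem lt_of_pos_lt {s t : ℕ} (h : pos D a s < pos D a t) : s < t := by
  by_contra h'
  have := pos_mono D a (not_lt.mp h')
  omega

theorem pos_of_gt {s t : ℕ} (h : s ∈ D) (h2 : a s = pos D a s) (hst : s < t) :
    a s + 1 ≤ pos D a t := by
  have := pos_mono D a (show s + 1 ≤ t from hst)
  rw [pos_succ_hit D a h h2] at this
  omega

theorem pos_le (N : ℕ) (hN : ∀ t ∈ D, a t < N) (t : ℕ) : pos D a t ≤ N := by
  induction t with
  | zero => simp [pos]
  | succ t ih =>
    simp only [pos]
    split_ifs with h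
    · have := hN t h.1
      omega
    · exact ih

theorem st_del (hu : ∀ j, j ≠ 0 → u 0 < u j) (hg : Good D a u)
    (D' : Set ℕ) [DecidablePred (· ∈ D')] (hD' : ∀ t, t ∈ D' ↔ t ∈ D ∧ a t ≠ pos D a t) (t : ℕ) :
    st D' (del D a) (fun j => u (j + 1)) t = fun j => st D a u t (skip (pos D a t) j) := by
  induction t with
  | zero => funext j; simp [st, pos, skip]
  | succ t ih =>
    by_cases hD : t ∈ D
    · have hne := ne_pos D a u hu hg hD
      by_cases hq : a t = pos D a t
      · have h1 : t ∉ D' := by rw [hD']; tauto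
        simp only [st, pos, hD, h1, hq, if_true, true_and, if_false, ih]
        funext j
        congr 1
        simp only [skip, Equiv.swap_apply_def]
        split_ifs <;> omega
      · have h1 : t ∈ D' := by rw [hD']; tauto
        simp only [st, pos, hD, h1, hq, if_true, and_false, if_false, ih]
        funext j
        congr 1
        simp only [skip, Equiv.swap_apply_def, del]
        split_ifs <;> omega
    · have h1 : t ∉ D' := by rw [hD']; tauto
      simp only [st, pos, hD, h1, if_false, false_and, ih]

theorem good_del (hu : ∀ j, j ≠ 0 → u 0 < u j) (hg : Good D a u)
    (D' : Set ℕ) [DecidablePred (· ∈ D')] (hD' : ∀ t, t ∈ D' ↔ t ∈ D ∧ a t ≠ pos D a t) :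
    Good D' (del D a) (fun j => u (j + 1)) := by
  intro t ht
  rw [st_del D a u hu hg D' hD']
  obtain ⟨hD, hq⟩ := (hD' t).1 ht
  have hne := ne_pos D a u hu hg hD
  have h1 : skip (pos D a t) (del D a t) = a t := by
    simp only [skip, del]; split_ifs <;> omega
  have h2 : skip (pos D a t) (del D a t + 1) = a t + 1 := by
    simp only [skip, del]; split_ifs <;> omega
  simp only [h1, h2]
  exact hg t hD

end

section
variable (D : Set ℕ) [DecidablePred (· ∈ D)]

/-- `e` before `g` in the common order leads to a contradiction. -/
theorem hit_aux (a b : ℕ → ℕ) (n : ℕ)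
    (ha : ∀ t ∈ D, a t + 1 ≠ pos D a t) (hb : ∀ t ∈ D, b t + 1 ≠ pos D b t)
    (hn : ∀ t ∈ D, t < n)
    (hv : pos D a n = pos D b n)
    (hp : ∀ s ∈ D, ∀ t ∈ D, s < t → (a s < a t ↔ b s < b t)) (c : ℕ)
    (ih : ∀ c' < c, ∀ e g, e ∈ D → g ∈ D → pos D a e = c' → a e = c' →
      pos D b g = c' → b g = c' → e = g)
    (e g : ℕ) (he : e ∈ D) (hg : g ∈ D) (hae : pos D a e = c) (hae' : a e = c)
    (hbg : pos D b g = c) (hbg' : b g = c)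
    (hlt : (e < g ∧ a e < a g) ∨ (g < e ∧ ¬ a g < a e)) : False := by
  have hbe_le : b e ≤ c := by
    rcases hlt with ⟨h1, h2⟩ | ⟨h1, h2⟩
    · -- then `e < g`
      have h3 := (hp e he g hg h1).1 h2
      omega
    · rw [hp g hg e he h1] at h2
      omega
  have hge : c ≤ b e ∧ (a g = c → ¬ g < e) := by
    rcases Nat.eq_zero_or_pos c with h0 | h0
    · subst h0
      refine ⟨Nat.zero_le _, ?_⟩
      intro h1 h2
      have h3 := pos_mono D a h2.le
      have h4 : a g = pos D a g := by omega
      have := pos_of_gt D a hg h4 h2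
      omega
    · obtain ⟨τ, h1, h2, h3, h4⟩ := exists_before D a (s := e) (c := c - 1) (by omega)
      obtain ⟨τ', h1', h2', h3', h4'⟩ := exists_before D b (s := g) (c := c - 1) (by omega)
      have hτ := ih (c - 1) (by omega) τ τ' h2 h2' h3 h4 h3' h4'
      subst hτ
      refine ⟨?_, ?_⟩
      · have := (hp τ h2 e he h1).1 (by omega)
        omega
      · intro h5 h6
        have h7 := pos_mono D a h6.le
        have h8 := pos_of_gt D a h2 (by omega) h1'
        have h9 : a g = pos D a g := by omega
        have := pos_of_gt D a hg h9 h6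
        omega
  have hbe : b e = c := le_antisymm hbe_le hge.1
  have hgelt : g < e := by
    rcases hlt with ⟨h1, h2⟩ | ⟨h1, h2⟩
    · have h3 := (hp e he g hg h1).1 h2
      omega
    · exact h1
  have hag : c + 1 ≤ a g := by
    have h1 := hge.2
    have h2 : ¬ a g < a e := by
      rcases hlt with h | h
      · omega
      · exact h.2
    by_contra h3
    exact h1 (by omega) hgelt
  have h5 := pos_of_gt D b hg (by omega) hgelt
  have h6 := hb e he
  have h7 := pos_mono D b (hn e he).le
  obtain ⟨h, h8, h9, h10, h11⟩ := exists_before D a (s := n) (c := c + 1) (by omega)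
  have h12 : e < h := lt_of_pos_lt D a (by omega)
  have h13 := (hp e he h h9 h12).1 (by omega)
  have h14 := (hp g hg h h9 (by omega)).2 (by omega)
  omega

theorem hit_eq (a b : ℕ → ℕ) (n : ℕ)
    (ha : ∀ t ∈ D, a t + 1 ≠ pos D a t) (hb : ∀ t ∈ D, b t + 1 ≠ pos D b t)
    (hn : ∀ t ∈ D, t < n)
    (hv : pos D a n = pos D b n)
    (hp : ∀ s ∈ D, ∀ t ∈ D, s < t → (a s < a t ↔ b s < b t)) (c : ℕ) :
    ∀ e g, e ∈ D → g ∈ D → pos D a e = c → a e = c →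
      pos D b g = c → b g = c → e = g := by
  induction c using Nat.strong_induction_on with
  | _ c ih =>
    intro e g he hg h1 h2 h3 h4
    by_contra hne
    by_cases hlt : (e < g ∧ a e < a g) ∨ (g < e ∧ ¬ a g < a e)
    · exact hit_aux D a b n ha hb hn hv hp c ih e g he hg h1 h2 h3 h4 hlt
    · refine hit_aux D b a n hb ha hn hv.symm (fun s hs t ht hst => (hp s hs t ht hst).symm) c
        (fun c' hc' e' g' he' hg' k1 k2 k3 k4 => (ih c' hc' g' e' hg' he' k3 k4 k1 k2).symm)
        g e hg he h3 h4 h1 h2 ?_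
      rcases lt_or_gt_of_ne hne with h | h
      · right
        refine ⟨h, ?_⟩
        rw [← hp e he g hg h]
        tauto
      · left
        refine ⟨h, ?_⟩
        rw [← hp g hg e he h]
        tauto

theorem pos_eq (a b : ℕ → ℕ) (n : ℕ)
    (ha : ∀ t ∈ D, a t + 1 ≠ pos D a t) (hb : ∀ t ∈ D, b t + 1 ≠ pos D b t)
    (hn : ∀ t ∈ D, t < n)
    (hv : pos D a n = pos D b n)
    (hp : ∀ s ∈ D, ∀ t ∈ D, s < t → (a s < a t ↔ b s < b t)) (t : ℕ) :
    pos D a t = pos D b t ∧ (t ∈ D → (a t = pos D a t ↔ b t = pos D b t)) := by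
  have key : ∀ t, pos D a t = pos D b t → (t ∈ D → (a t = pos D a t ↔ b t = pos D b t)) := by
    intro t h hD
    have hE := hit_eq D a b n ha hb hn hv hp (pos D a t)
    constructor
    · intro h1
      have h2 := pos_of_gt D a hD h1 (hn t hD)
      obtain ⟨g, -, h4, h5, h6⟩ := exists_before D b (s := n) (c := pos D a t) (by omega)
      have := hE t g hD h4 rfl h1 h5 h6
      subst this
      omega
    · intro h1
      have h2 := pos_of_gt D b hD h1 (hn t hD)
      obtain ⟨g, -, h4, h5, h6⟩ := exists_before D a (s := n) (c := pos D a t) (by omega)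
      have := hE g t h4 hD h5 h6 h.symm (by omega)
      subst this
      omega
  have main : pos D a t = pos D b t := by
    induction t with
    | zero => rfl
    | succ t ih =>
      by_cases hD : t ∈ D
      · have := key t ih hD
        simp only [pos, hD, true_and]
        split_ifs <;> omega
      · simp only [pos, hD, false_and, if_false, ih]
  exact ⟨main, key t main⟩

end

section
variable (D : Set ℕ) [DecidablePred (· ∈ D)]

/-- One implication of the preservation of the pattern. -/
theorem pattern_aux (a b : ℕ → ℕ)
    (ha : ∀ t ∈ D, a t + 1 ≠ pos D a t) (hb : ∀ t ∈ D, b t + 1 ≠ pos D b t)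
    (hq : ∀ t, pos D a t = pos D b t ∧ (t ∈ D → (a t = pos D a t ↔ b t = pos D b t)))
    (hp : ∀ s ∈ D, ∀ t ∈ D, s < t → (a s < a t ↔ b s < b t))
    (s t : ℕ) (hs : s ∈ D) (ht : t ∈ D) (hs' : a s ≠ pos D a s) (ht' : a t ≠ pos D a t)
    (hst : s < t) (h : del D a s < del D a t) : del D b s < del D b t := by
  have above : ∀ r ∈ D, a r ≠ pos D a r → (a r < pos D a r ↔ b r < pos D b r) := by
    intro r hr hr'
    have h1 := (hq r).1
    have h2 := (hq r).2 hr
    rcases Nat.eq_zero_or_pos (pos D a r) with h0 | h0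
    · omega
    · obtain ⟨τ, h3, h4, h5, h6⟩ := exists_before D a (s := r) (c := pos D a r - 1) (by omega)
      have h7 := hp τ h4 r hr h3
      have h8 := (hq τ).1
      have h9 := (hq τ).2 h4
      have h10 : b τ = a τ := by omega
      omega
  have as := above s hs hs'
  have at' := above t ht ht'
  have hs2 := (hq s).2 hs
  have ht2 := (hq t).2 ht
  have hs1 := (hq s).1
  have ht1 := (hq t).1
  have hps := hp s hs t ht hst
  have hm := pos_mono D a hst.le
  have n1 := ha s hs
  have n2 := ha t ht
  have n3 := hb s hs
  have n4 := hb t ht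
  by_cases htie : a s = a t ∧ pos D a s < a s ∧ a t < pos D a t
  · obtain ⟨e1, e2, e3⟩ := htie
    have val : ∀ c, pos D a s ≤ c → c < pos D a t →
        ∃ r ∈ D, s < r ∧ r < t ∧ a r = c ∧ b r = c := by
      intro c hc1 hc2
      obtain ⟨r, k1, k2, k3, k4⟩ := exists_before D a hc2
      have k5 := (hq r).1
      have k6 := (hq r).2 k2
      refine ⟨r, k2, ?_, k1, k4, by omega⟩
      rcases Nat.lt_trichotomy s r with k | k | k
      · exact k
      · subst k; omega
      · have := pos_of_gt D a k2 (by omega) k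
        omega
    obtain ⟨r1, m1, m2, m3, m4, m5⟩ := val (a s) (by omega) (by omega)
    obtain ⟨r2, q1, q2, q3, q4, q5⟩ := val (a s + 1) (by omega) (by omega)
    obtain ⟨r0, p1, p2, p3, p4, p5⟩ := val (a s - 1) (by omega) (by omega)
    have u1 := hp s hs r1 m1 m2
    have u2 := hp s hs r2 q1 q2
    have u3 := hp r1 m1 t ht m3
    have u4 := hp r0 p1 t ht p3
    have v1 : b s = a s := by omega
    have v2 : b t = a s := by omega
    simp only [del] at h ⊢
    split_ifs at h ⊢ <;> omega
  · simp only [del] at h ⊢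
    split_ifs at h ⊢ <;> omega

end

open scoped Classical in
theorem word_unique (n N : ℕ) : ∀ (D : Set ℕ) (a b u : ℕ → ℕ),
    (∀ t ∈ D, t < n) → (∀ t ∈ D, a t < N) → (∀ t ∈ D, b t < N) → StrictMono u →
    Good D a u → Good D b u → st D a u n = st D b u n →
    (∀ s ∈ D, ∀ t ∈ D, s < t → (a s < a t ↔ b s < b t)) → ∀ t ∈ D, a t = b t := by
  induction N with
  | zero =>
    intro D a b u _ h _ _ _ _ _ _ t ht
    exact absurd (h t ht) (by omega)
  | succ N ih =>
    intro D a b u hn hNa hNb hu hga hgb hfin hp t ht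
    have hu0 : ∀ j, j ≠ 0 → u 0 < u j := fun j hj => hu (Nat.pos_of_ne_zero hj)
    have ha : ∀ t ∈ D, a t + 1 ≠ pos D a t := fun t ht => ne_pos D a u hu0 hga ht
    have hb : ∀ t ∈ D, b t + 1 ≠ pos D b t := fun t ht => ne_pos D b u hu0 hgb ht
    have hv : pos D a n = pos D b n := by
      by_contra hne
      have h1 := (wire D a u hu0 hga n).1
      have h2 := (wire D b u hu0 hgb n).2 _ hne
      rw [hfin] at h1
      omega
    have hq := pos_eq D a b n ha hb hn hv hp
    obtain ⟨D', hDa⟩ : ∃ D' : Set ℕ, ∀ t, t ∈ D' ↔ t ∈ D ∧ a t ≠ pos D a t :=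
      ⟨{t | t ∈ D ∧ a t ≠ pos D a t}, fun t => Iff.rfl⟩
    have hDb : ∀ t, t ∈ D' ↔ t ∈ D ∧ b t ≠ pos D b t := by
      intro t
      have := (hq t).2
      rw [hDa]
      tauto
    have hple := pos_le D a (N + 1) hNa
    have hple' := pos_le D b (N + 1) hNb
    have res := ih D' (del D a) (del D b) (fun j => u (j + 1))
      (fun t ht => hn t ((hDa t).1 ht).1)
      (by
        intro t ht
        replace ht := (hDa t).1 ht
        have h1 := hNa t ht.1
        have h2 := ha t ht.1
        have h3 := hple t
        have h4 := ht.2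
        simp only [del]
        split_ifs <;> omega)
      (by
        intro t ht
        have ht' := (hDb t).1 ht
        have h1 := hNb t ht'.1
        have h2 := hb t ht'.1
        have h3 := hple' t
        have h4 := ht'.2
        simp only [del]
        split_ifs <;> omega)
      (fun i j hij => hu (by omega))
      (good_del D a u hu0 hga _ hDa) (good_del D b u hu0 hgb _ hDb)
      (by
        rw [st_del D a u hu0 hga _ hDa, st_del D b u hu0 hgb _ hDb, hfin, hv])
      (by
        intro s hs t ht hst
        have hs0 := (hDa s).1 hs
        have ht0 := (hDa t).1 ht
        constructor
        · exact pattern_aux D a b ha hb hq hp s t hs0.1 ht0.1 hs0.2 ht0.2 hst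
        · refine pattern_aux D b a hb ha
            (fun t => ⟨(hq t).1.symm, fun h => ((hq t).2 h).symm⟩)
            (fun s hs t ht hst => (hp s hs t ht hst).symm) s t hs0.1 ht0.1
            ((hDb s).1 hs).2 ((hDb t).1 ht).2 hst)
    by_cases h : a t = pos D a t
    · have := ((hq t).2 ht).1 h
      have := (hq t).1
      omega
    · have h1 := res t ((hDa t).2 ⟨ht, h⟩)
      have h2 := (hq t).1
      have h3 := ha t ht
      have h4 := hb t ht
      have h5 := (hq t).2 ht
      simp only [del] at h1
      split_ifs at h1 <;> omega

/-! ### Reduced words -/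

theorem exchange (i : ℕ) : ∀ l : List ℕ,
    (l.map EGs).prod (i + 1) < (l.map EGs).prod i →
    ∃ l' : List ℕ, (l'.map EGs).prod = (l.map EGs).prod * EGs i ∧ l'.length + 1 = l.length := by
  intro l
  induction l with
  | nil => intro h; simp at h
  | cons j l ih =>
    intro h
    by_cases h0 : (l.map EGs).prod (i + 1) < (l.map EGs).prod i
    · obtain ⟨l', h1, h2⟩ := ih h0
      exact ⟨j :: l', by simp [h1, mul_assoc], by simp [h2]⟩
    · refine ⟨l, ?_, rfl⟩
      have hne : (l.map EGs).prod (i + 1) ≠ (l.map EGs).prod i := by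
        intro he
        have := (l.map EGs).prod.injective he
        omega
      have hval : (l.map EGs).prod i = j ∧ (l.map EGs).prod (i + 1) = j + 1 := by
        simp only [List.map_cons, List.prod_cons, Equiv.Perm.mul_apply] at h
        generalize (l.map EGs).prod i = x at *
        generalize (l.map EGs).prod (i + 1) = y at *
        simp only [EGs, Equiv.swap_apply_def] at h
        split_ifs at h <;> omega
      have h3 : (l.map EGs).prod * EGs i = EGs j * (l.map EGs).prod := by
        have := Equiv.mul_swap_eq_swap_mul (l.map EGs).prod i (i + 1)
        rw [hval.1, hval.2] at this
        exact this
      have h4 : EGs j * EGs j = 1 := Equiv.swap_mul_self _ _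
      rw [List.map_cons, List.prod_cons, mul_assoc, h3, ← mul_assoc, h4, one_mul]

theorem reduced_good {w : Equiv.Perm ℕ} {l : List ℕ} (h : IsReducedWord w l) (t : ℕ)
    (ht : t < l.length) :
    ((l.take t).map EGs).prod (l[t]) < ((l.take t).map EGs).prod (l[t] + 1) := by
  by_contra hcon
  have hne : ((l.take t).map EGs).prod (l[t] + 1) ≠ ((l.take t).map EGs).prod (l[t]) := by
    intro he
    have := ((l.take t).map EGs).prod.injective he
    omega
  obtain ⟨l', h1, h2⟩ := exchange l[t] (l.take t) (by omega)
  have h3 : ((l' ++ l.drop (t + 1)).map EGs).prod = w := by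
    rw [List.map_append, List.prod_append, h1, mul_assoc, ← List.prod_cons, ← List.map_cons,
      ← List.drop_eq_getElem_cons ht, ← List.prod_append, ← List.map_append, List.take_append_drop]
    exact h.1
  have h4 : coxLength w ≤ (l' ++ l.drop (t + 1)).length := Nat.sInf_le ⟨_, h3, rfl⟩
  have h5 := h.2
  simp only [List.length_append, List.length_drop] at h4
  simp only [List.length_take] at h2
  omega

/-- The times before `n`. -/
def upto (n : ℕ) : Set ℕ := {t | t < n}

theorem mem_upto {n t : ℕ} : t ∈ upto n ↔ t < n := Iff.rfl

open scoped Classical in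
theorem st_list (l : List ℕ) (t : ℕ) (ht : t ≤ l.length) :
    st (upto l.length) (fun t => l.getD t 0) id t = ((l.take t).map EGs).prod := by
  induction t with
  | zero => funext j; simp [st]
  | succ t ih =>
    have h1 : t < l.length := ht
    rw [List.take_succ_eq_append_getElem h1]
    simp only [st, mem_upto, h1, if_true, ih h1.le]
    funext j
    simp [EGs, h1]

open scoped Classical in
theorem list_unique {w : Equiv.Perm ℕ} {l m : List ℕ} (hl : IsReducedWord w l)
    (hm : IsReducedWord w m)
    (hp : ∀ s t (hst : s < t) (h1 : t < l.length) (h2 : t < m.length),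
      (l[s] < l[t] ↔ m[s] < m[t])) : l = m := by
  have hlen : l.length = m.length := hl.2.trans hm.2.symm
  have good : ∀ k : List ℕ, IsReducedWord w k →
      Good (upto k.length) (fun t => k.getD t 0) id := by
    intro k hk t ht
    have ht' : t < k.length := ht
    rw [st_list k t ht'.le]
    have := reduced_good hk t ht'
    simpa [ht'] using this
  have gm := good m hm
  have fm := st_list m m.length le_rfl
  rw [List.take_length, hm.1, ← hlen] at fm
  rw [← hlen] at gm
  have fl := st_list l l.length le_rfl
  rw [List.take_length, hl.1] at fl
  have key := word_unique l.length (l.sum + m.sum + 1) (upto l.length)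
    (fun t => l.getD t 0) (fun t => m.getD t 0) id (fun t ht => ht)
    (by
      intro t ht
      have ht' : t < l.length := ht
      have := List.le_sum_of_mem (List.getElem_mem ht')
      simp only [List.getD_eq_getElem _ _ ht']
      omega)
    (by
      intro t ht
      have ht' : t < m.length := hlen ▸ ht
      have := List.le_sum_of_mem (List.getElem_mem ht')
      simp only [List.getD_eq_getElem _ _ ht']
      omega)
    strictMono_id (good l hl) gm (fl.trans fm.symm)
    (by
      intro s hs t ht hst
      have hs' : s < l.length := hs
      have ht' : t < l.length := ht
      simp only [List.getD_eq_getElem _ _ ht', List.getD_eq_getElem _ _ hs',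
        List.getD_eq_getElem _ _ (hlen ▸ ht'), List.getD_eq_getElem _ _ (hlen ▸ hs')]
      exact hp s t hst ht' (hlen ▸ ht'))
  apply List.ext_getElem hlen
  intro t h1 h2
  have := key t h1
  simpa only [List.getD_eq_getElem _ _ h1, List.getD_eq_getElem _ _ h2] using this

/-! ### Tableaux -/

/-- The cells in reading order. -/
def cellList (μ : YoungDiagram) : List (ℕ × ℕ) :=
  (List.range (μ.colLen 0)).flatMap fun i =>
    ((List.range (μ.rowLen i)).reverse).map fun j => (i, j)

theorem readingWord_eq (μ : YoungDiagram) (T : ℕ → ℕ → ℕ) :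
    readingWord μ T = (cellList μ).map fun c => T c.1 c.2 := by
  simp [readingWord, cellList, List.map_flatMap, Function.comp_def]

theorem mem_cellList (μ : YoungDiagram) (c : ℕ × ℕ) : c ∈ cellList μ ↔ c ∈ μ.cells := by
  obtain ⟨i, j⟩ := c
  simp only [cellList, List.mem_flatMap, List.mem_range, List.mem_map, List.mem_reverse,
    Prod.mk.injEq, YoungDiagram.mem_cells]
  constructor
  · rintro ⟨i', h1, j', h2, rfl, rfl⟩
    exact YoungDiagram.mem_iff_lt_rowLen.2 h2
  · intro h
    refine ⟨i, ?_, j, YoungDiagram.mem_iff_lt_rowLen.1 h, rfl, rfl⟩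
    exact YoungDiagram.mem_iff_lt_colLen.1 (μ.up_left_mem le_rfl (Nat.zero_le _) h)

theorem pairwise_cellList (μ : YoungDiagram) :
    (cellList μ).Pairwise fun c d => c.1 < d.1 ∨ (c.1 = d.1 ∧ d.2 < c.2) := by
  rw [cellList, List.pairwise_flatMap]
  constructor
  · intro i _
    rw [List.pairwise_map, List.pairwise_reverse]
    exact List.pairwise_lt_range.imp (fun h => Or.inr ⟨rfl, h⟩)
  · refine List.pairwise_lt_range.imp ?_
    intro i i' h x hx y hy
    simp only [List.mem_map] at hx hy
    obtain ⟨_, _, rfl⟩ := hx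
    obtain ⟨_, _, rfl⟩ := hy
    exact Or.inl h

/-- The total order on cells used for standardization. -/
def Before (T : ℕ → ℕ → ℕ) (c d : ℕ × ℕ) : Prop :=
  T c.1 c.2 < T d.1 d.2 ∨ (T c.1 c.2 = T d.1 d.2 ∧ c.2 < d.2) ∨
        (T c.1 c.2 = T d.1 d.2 ∧ c.2 = d.2 ∧ c.1 ≤ d.1)

theorem std_lt (μ : YoungDiagram) (T : ℕ → ℕ → ℕ) {c d : ℕ × ℕ} (hc : c ∈ μ.cells)
    (hd : d ∈ μ.cells) (h : ¬ Before T d c) : stdEntry μ T c.1 c.2 < stdEntry μ T d.1 d.2 := by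
  have hc' : (c.1, c.2) ∈ μ.cells := hc
  have hd' : (d.1, d.2) ∈ μ.cells := hd
  unfold stdEntry
  rw [if_pos hc', if_pos hd']
  unfold Before at h
  apply Finset.card_lt_card
  rw [Finset.ssubset_iff_of_subset]
  · refine ⟨d, ?_, ?_⟩
    · rw [Finset.mem_filter]
      refine ⟨hd, Or.inr (Or.inr ⟨rfl, rfl, le_rfl⟩)⟩
    · rw [Finset.mem_filter]
      exact fun h' => h h'.2
  · intro e he
    rw [Finset.mem_filter] at he ⊢
    refine ⟨he.1, ?_⟩
    have := he.2
    omega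

theorem std_lt_iff (μ : YoungDiagram) (T : ℕ → ℕ → ℕ) {c d : ℕ × ℕ} (hc : c ∈ μ.cells)
    (hd : d ∈ μ.cells) : stdEntry μ T c.1 c.2 < stdEntry μ T d.1 d.2 ↔ ¬ Before T d c := by
  refine ⟨fun h h' => ?_, std_lt μ T hc hd⟩
  by_cases hb : Before T c d
  · have : c = d := by
      unfold Before at h' hb
      ext <;> omega
    subst this
    omega
  · have := std_lt μ T hd hc hb
    omega

theorem maps (μ : YoungDiagram) (T : ℕ → ℕ → ℕ)
    (h1 : ∀ i j1 j2, j1 < j2 → (i, j2) ∈ μ.cells → T i j1 < T i j2)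
    (h2 : ∀ i1 i2 j, i1 < i2 → (i2, j) ∈ μ.cells → T i1 j < T i2 j) :
    stdEntry μ T ∈ SYTset μ := by
  refine ⟨?_, ?_, ?_, ?_⟩
  · intro i j1 j2 h hm
    have hm' : (i, j1) ∈ μ.cells := μ.up_left_mem le_rfl h.le hm
    refine std_lt μ T (c := (i, j1)) (d := (i, j2)) hm' hm ?_
    have := h1 i j1 j2 h hm
    simp only [Before]
    omega
  · intro i1 i2 j h hm
    have hm' : (i1, j) ∈ μ.cells := μ.up_left_mem h.le le_rfl hm
    refine std_lt μ T (c := (i1, j)) (d := (i2, j)) hm' hm ?_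
    have := h2 i1 i2 j h hm
    simp only [Before]
    omega
  · intro i j hm
    simp only [stdEntry, if_neg hm]
  · apply Finset.eq_of_subset_of_card_le
    · intro k hk
      rw [Finset.mem_image] at hk
      obtain ⟨c, hc, rfl⟩ := hk
      have hc' : (c.1, c.2) ∈ μ.cells := hc
      rw [Finset.mem_Icc]
      unfold stdEntry
      rw [if_pos hc']
      refine ⟨Finset.card_pos.2 ⟨c, ?_⟩, Finset.card_filter_le _ _⟩
      rw [Finset.mem_filter]
      exact ⟨hc, Or.inr (Or.inr ⟨rfl, rfl, le_rfl⟩)⟩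
    · rw [Finset.card_image_of_injOn]
      · simp
      · intro c hc d hd hcd
        have e1 := std_lt_iff μ T hc hd
        have e2 := std_lt_iff μ T hd hc
        simp only at hcd
        have f1 : Before T d c := by
          by_contra h
          have := e1.2 h
          omega
        have f2 : Before T c d := by
          by_contra h
          have := e2.2 h
          omega
        unfold Before at f1 f2
        ext <;> omega

theorem std_reading (μ : YoungDiagram) (T : ℕ → ℕ → ℕ)
    (h1 : ∀ i j1 j2, j1 < j2 → (i, j2) ∈ μ.cells → T i j1 < T i j2)
    (h2 : ∀ i1 i2 j, i1 < i2 → (i2, j) ∈ μ.cells → T i1 j < T i2 j)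
    {c d : ℕ × ℕ} (hc : c ∈ μ.cells) (hd : d ∈ μ.cells)
    (hcd : c.1 < d.1 ∨ (c.1 = d.1 ∧ d.2 < c.2)) :
    T c.1 c.2 < T d.1 d.2 ↔ stdEntry μ T c.1 c.2 < stdEntry μ T d.1 d.2 := by
  rw [std_lt_iff μ T hc hd]
  obtain ⟨i, j⟩ := c
  obtain ⟨k, l⟩ := d
  simp only [Before] at *
  rcases hcd with h | ⟨rfl, h⟩
  · rcases Nat.lt_or_ge l j with h' | h'
    · omega
    · have e1 := h2 i k l h hd
      have e2 : T i j ≤ T i l := by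
        rcases h'.eq_or_lt with h'' | h''
        · rw [h'']
        · exact (h1 i j l h'' (μ.up_left_mem h.le le_rfl hd)).le
      omega
  · have := h1 i l j h hc
    omega

end EGProof

/-- Standardization is an injection from Edelman–Greene tableaux of type `(μ, w)`
into standard Young tableaux of shape `μ`. -/
theorem stmt7 (μ : YoungDiagram) (w : Equiv.Perm ℕ) :
    Set.MapsTo (fun T => stdEntry μ T) (EGset μ w) (SYTset μ) ∧
    Set.InjOn (fun T => stdEntry μ T) (EGset μ w) := by
  refine ⟨fun T hT => EGProof.maps μ T hT.1 hT.2.1, ?_⟩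
  intro T hT S hS hTS
  simp only at hTS
  obtain ⟨t1, t2, t3, t4⟩ := hT
  obtain ⟨s1, s2, s3, s4⟩ := hS
  rw [EGProof.readingWord_eq] at t4 s4
  have key := EGProof.list_unique t4 s4 (by
    intro s t hst k1 k2
    simp only [List.length_map] at k1 k2
    have hpw := List.pairwise_iff_getElem.1 (EGProof.pairwise_cellList μ) s t (by omega) k1 hst
    have m1 := (EGProof.mem_cellList μ _).1 (List.getElem_mem (show s < _ by omega))
    have m2 := (EGProof.mem_cellList μ _).1 (List.getElem_mem k1)
    simp only [List.getElem_map]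
    rw [EGProof.std_reading μ T t1 t2 m1 m2 hpw, EGProof.std_reading μ S s1 s2 m1 m2 hpw, hTS])
  rw [List.map_inj_left] at key
  funext i j
  by_cases hm : (i, j) ∈ μ.cells
  · exact key (i, j) ((EGProof.mem_cellList μ _).2 hm)
  · rw [t3 i j hm, s3 i j hm]
end

section
/- For any partition λ and permutation w ∈ S_∞, the number a_{w,λ} of Edelman–Greene tableaux of type (λ, w) is at most f^λ, the number of standard Young tableaux of shape λ. -/
open Equiv

/-- Product of a word. -/
def wP (l : List ℕ) : Equiv.Perm ℕ := (l.map EGs).prod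

theorem wP_nil : wP [] = 1 := rfl
theorem wP_cons (x : ℕ) (l : List ℕ) : wP (x :: l) = EGs x * wP l := by simp [wP]
theorem wP_append (l l' : List ℕ) : wP (l ++ l') = wP l * wP l' := by simp [wP]

theorem EGs_apply (x q : ℕ) :
    EGs x q = if q = x then x + 1 else if q = x + 1 then x else q := by
  simp [EGs, Equiv.swap_apply_def]

theorem EGs_sq (x : ℕ) : EGs x * EGs x = 1 := by simp [EGs]

theorem EGs_comm (x y : ℕ) (h : x + 1 < y) : EGs x * EGs y = EGs y * EGs x := by
  ext q
  simp only [Equiv.Perm.mul_apply, EGs_apply]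
  split_ifs <;> omega

theorem EGs_braid (x : ℕ) :
    EGs (x + 1) * (EGs x * EGs (x + 1)) = EGs x * (EGs (x + 1) * EGs x) := by
  ext q
  simp only [Equiv.Perm.mul_apply, EGs_apply]
  split_ifs <;> omega

/-- The word `q, q+1, …, q+k-1`. -/
def cw (q k : ℕ) : Equiv.Perm ℕ := wP (List.range' q k)

theorem cw_succ (q k : ℕ) : cw q (k + 1) = EGs q * cw (q + 1) k := by
  simp [cw, List.range'_succ, wP_cons]

theorem cw_comm_low (k : ℕ) : ∀ (x q : ℕ), x + 1 < q → EGs x * cw q k = cw q k * EGs x := by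
  induction k with
  | zero => intro x q _; simp [cw, wP]
  | succ k ih =>
    intro x q h
    rw [cw_succ, ← mul_assoc, EGs_comm x q h, mul_assoc, ih x (q + 1) (by omega), mul_assoc]

theorem cw_comm_high (k : ℕ) : ∀ (x q : ℕ), q ≤ x → x + 1 < q + k →
    EGs (x + 1) * cw q k = cw q k * EGs x := by
  induction k with
  | zero => intro x q _ h; omega
  | succ k ih =>
    intro x q h h2
    rcases Nat.lt_or_ge q x with h3 | h3
    · rw [cw_succ, ← mul_assoc, ← EGs_comm q (x + 1) (by omega), mul_assoc,
        ih x (q + 1) (by omega) (by omega), mul_assoc]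
    · obtain rfl : q = x := by omega
      obtain ⟨k, rfl⟩ : ∃ m, k = m + 1 := ⟨k - 1, by omega⟩
      rw [cw_succ, cw_succ]
      have := cw_comm_low k q (q + 1 + 1) (by omega)
      have h5 := EGs_braid q
      calc EGs (q + 1) * (EGs q * (EGs (q + 1) * cw (q + 1 + 1) k))
          = (EGs (q + 1) * (EGs q * EGs (q + 1))) * cw (q + 1 + 1) k := by
            simp only [mul_assoc]
        _ = EGs q * (EGs (q + 1) * (EGs q * cw (q + 1 + 1) k)) := by
            rw [h5]; simp only [mul_assoc]
        _ = _ := by rw [this]; simp only [mul_assoc]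

/-- Remove the strand starting at `N`. -/
def delW (N : ℕ) : List ℕ → List ℕ
  | [] => []
  | x :: l =>
    if x + 1 = wP l N then delW N l
    else if x = wP l N then delW N l
    else if wP l N < x then (x - 1) :: delW N l
    else x :: delW N l

theorem delW_cons (N x : ℕ) (l : List ℕ) : delW N (x :: l) =
    if x + 1 = wP l N then delW N l
    else if x = wP l N then delW N l
    else if wP l N < x then (x - 1) :: delW N l
    else x :: delW N l := rfl

/-- The strand starting at `N` never goes up. -/
def NR (N : ℕ) : List ℕ → Prop
  | [] => True
  | x :: l => x ≠ wP l N ∧ NR N l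

theorem wP_le (N : ℕ) (l : List ℕ) (h : ∀ x ∈ l, x < N) : wP l N ≤ N := by
  induction l with
  | nil => simp [wP]
  | cons x l ih =>
    have := ih (fun y hy => h y (by simp [hy]))
    have hx := h x (by simp)
    rw [wP_cons, Equiv.Perm.mul_apply, EGs_apply]
    split_ifs <;> omega

theorem delW_lt (N : ℕ) (l : List ℕ) (h : ∀ x ∈ l, x < N + 1) :
    ∀ x ∈ delW (N + 1) l, x < N := by
  induction l with
  | nil => simp [delW]
  | cons x l ih =>
    have ih := ih (fun y hy => h y (by simp [hy]))
    have hx := h x (by simp)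
    have hq := wP_le (N + 1) l (fun y hy => h y (by simp [hy]))
    rw [delW_cons]
    split_ifs with h1 h2 h3
    · exact ih
    · exact ih
    · intro y hy
      rcases List.mem_cons.1 hy with rfl | hy
      · omega
      · exact ih y hy
    · intro y hy
      rcases List.mem_cons.1 hy with rfl | hy
      · omega
      · exact ih y hy

theorem delW_prod (N : ℕ) (l : List ℕ) (h : ∀ x ∈ l, x < N) :
    wP l = cw (wP l N) (N - wP l N) * wP (delW N l) := by
  induction l with
  | nil => simp [delW, wP, cw]
  | cons x l ih =>
    have ih := ih (fun y hy => h y (by simp [hy]))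
    have hx := h x (by simp)
    have hq := wP_le N l (fun y hy => h y (by simp [hy]))
    have hv : wP (x :: l) N = EGs x (wP l N) := by rw [wP_cons, Equiv.Perm.mul_apply]
    rw [hv]
    conv_lhs => rw [wP_cons, ih]
    rw [delW_cons]
    generalize wP l N = q at *
    rw [EGs_apply]
    by_cases k1 : q = x
    · subst k1
      rw [if_pos rfl, if_neg (by omega), if_pos rfl]
      obtain ⟨k, hk⟩ : ∃ m, N - q = m + 1 := ⟨N - q - 1, by omega⟩
      rw [hk, cw_succ, show N - (q + 1) = k by omega, ← mul_assoc, ← mul_assoc, EGs_sq, one_mul]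
    rw [if_neg k1]
    by_cases k2 : q = x + 1
    · subst k2
      rw [if_pos rfl, if_pos rfl, show N - x = (N - (x + 1)) + 1 by omega, cw_succ, mul_assoc]
    rw [if_neg k2, if_neg (Ne.symm k2), if_neg (Ne.symm k1)]
    by_cases k3 : q < x
    · obtain ⟨y, rfl⟩ : ∃ y, x = y + 1 := ⟨x - 1, by omega⟩
      rw [if_pos k3, wP_cons, ← mul_assoc, cw_comm_high _ y q (by omega) (by omega), mul_assoc]
      simp
    · rw [if_neg k3, wP_cons, ← mul_assoc, cw_comm_low _ x q (by omega), mul_assoc]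

theorem delW_length (N : ℕ) (l : List ℕ) (h : ∀ x ∈ l, x < N) :
    (delW N l).length + (N - wP l N) ≤ l.length ∧
    (¬ NR N l → (delW N l).length + (N - wP l N) < l.length) := by
  induction l with
  | nil => simp [delW, wP, NR]
  | cons x l ih =>
    obtain ⟨ih1, ih2⟩ := ih (fun y hy => h y (by simp [hy]))
    have hx := h x (by simp)
    have hq := wP_le N l (fun y hy => h y (by simp [hy]))
    have hv : wP (x :: l) N = EGs x (wP l N) := by rw [wP_cons, Equiv.Perm.mul_apply]
    rw [hv]
    rw [delW_cons]
    unfold NR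
    generalize wP l N = q at *
    rw [EGs_apply]
    by_cases hn : NR N l
    · simp only [hn, and_true]
      split_ifs <;> simp only [List.length_cons] <;> omega
    · have := ih2 hn
      simp only [hn, and_false]
      split_ifs <;> simp only [List.length_cons] <;> omega

/-- Minimality of a word. -/
def MinW (l : List ℕ) : Prop := ∀ l2, wP l2 = wP l → l.length ≤ l2.length

theorem MinW.nr {N : ℕ} {l : List ℕ} (hm : MinW l) (h : ∀ x ∈ l, x < N) : NR N l := by
  by_contra hn
  have h1 := (delW_length N l h).2 hn
  have h2 := hm (List.range' (wP l N) (N - wP l N) ++ delW N l)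
    (by rw [wP_append]; exact (delW_prod N l h).symm)
  simp at h2
  omega

theorem MinW.del {N : ℕ} {l : List ℕ} (hm : MinW l) (h : ∀ x ∈ l, x < N) : MinW (delW N l) := by
  intro l2 h2
  have h1 := (delW_length N l h).1
  have h3 := hm (List.range' (wP l N) (N - wP l N) ++ l2)
    (by rw [wP_append, h2]; exact (delW_prod N l h).symm)
  simp at h3
  omega

/-- Same strict ascents. -/
def Asc (p r : ℕ × ℕ) : Prop := p.1 < r.1 ↔ p.2 < r.2

/-- Diverged state: the second path is ahead. -/
def Dv (N : ℕ) (L : List (ℕ × ℕ)) (qa qb : ℕ) : Prop :=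
  qb < qa ∧ qa ≤ N ∧ (∀ g, qb ≤ g → g < qa → ∃ r ∈ L, r.2 = g ∧ r.1 < g) ∧
    (qa = N ∨ (qa, qa) ∈ L)

theorem Dv.step {N : ℕ} {L : List (ℕ × ℕ)} {qa qb x y : ℕ} (h : Dv N L qa qb)
    (hA : ∀ r ∈ L, Asc (x, y) r) (hy : y < N) (hxa : x ≠ qa) (hyb : y ≠ qb) :
    Dv N ((x, y) :: L) (EGs x qa) (EGs y qb) := by
  obtain ⟨h1, h2, h3, h4⟩ := h
  have hc : x < qa → y < qa := by
    rcases h4 with rfl | h4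
    · intro _; exact hy
    · exact (hA _ h4).1
  rw [EGs_apply, EGs_apply, if_neg (Ne.symm hxa), if_neg (Ne.symm hyb)]
  by_cases ha : qa = x + 1
  · obtain ⟨r, hr, hr1, hr2⟩ := h3 x (by omega) (by omega)
    have := hA r hr
    simp only [Asc] at this
    have hxy : y = x := by omega
    subst hxy
    rw [if_pos ha, if_neg (by omega)]
    refine ⟨by omega, by omega, ?_, Or.inr (by simp)⟩
    intro g hg1 hg2
    obtain ⟨s, hs, hs'⟩ := h3 g hg1 (by omega)
    exact ⟨s, by simp [hs], hs'⟩
  · rw [if_neg ha]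
    have h4' : qa = N ∨ (qa, qa) ∈ (x, y) :: L := h4.imp id (fun h => by simp [h])
    by_cases hb : qb = y + 1
    · rw [if_pos hb]
      refine ⟨by omega, h2, ?_, h4'⟩
      intro g hg1 hg2
      by_cases hg : g = y
      · obtain ⟨r, hr, hr1, hr2⟩ := h3 qb le_rfl h1
        have := hA r hr
        simp only [Asc] at this
        exact ⟨(x, y), by simp, hg.symm, by simp only; omega⟩
      · obtain ⟨s, hs, hs'⟩ := h3 g (by omega) (by omega)
        exact ⟨s, by simp [hs], hs'⟩
    · rw [if_neg hb]
      refine ⟨h1, h2, ?_, h4'⟩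
      intro g hg1 hg2
      obtain ⟨s, hs, hs'⟩ := h3 g hg1 hg2
      exact ⟨s, by simp [hs], hs'⟩

/-- How an element of the reduced pair list arises. -/
def PInv (N q : ℕ) (r' : ℕ × ℕ) (r : ℕ × ℕ) : Prop :=
  ∃ Q, q ≤ Q ∧ Q ≤ N ∧ (∀ g, q ≤ g → g < Q → (g < r.1 ↔ g < r.2)) ∧
    ((r'.1 = r.1 ∧ r'.2 = r.2 ∧ r.1 + 1 < Q ∧ r.2 + 1 < Q) ∨
      (r'.1 + 1 = r.1 ∧ r'.2 + 1 = r.2 ∧ Q < r.1 ∧ Q < r.2))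

/-- Synchronised state. -/
def Sy (N : ℕ) (L : List (ℕ × ℕ)) (q : ℕ) : Prop :=
  q ≤ N ∧ (∀ g, q ≤ g → g < N → (g, g) ∈ L) ∧
  ∃ L' : List (ℕ × ℕ), L'.map Prod.fst = delW N (L.map Prod.fst) ∧
    L'.map Prod.snd = delW N (L.map Prod.snd) ∧ L'.Pairwise Asc ∧
    (∀ r' ∈ L', ∃ r ∈ L, PInv N q r' r) ∧
    (L'.map Prod.fst = L'.map Prod.snd → L.map Prod.fst = L.map Prod.snd)

theorem trich (N : ℕ) (L : List (ℕ × ℕ)) (hL : ∀ r ∈ L, r.1 < N ∧ r.2 < N)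
    (hA : L.Pairwise Asc) (ha : NR N (L.map Prod.fst)) (hb : NR N (L.map Prod.snd)) :
    (wP (L.map Prod.fst) N = wP (L.map Prod.snd) N ∧ Sy N L (wP (L.map Prod.fst) N)) ∨
    Dv N L (wP (L.map Prod.fst) N) (wP (L.map Prod.snd) N) ∨
    Dv N (L.map Prod.swap) (wP (L.map Prod.snd) N) (wP (L.map Prod.fst) N) := by
  induction L with
  | nil =>
    left
    refine ⟨rfl, by simp [wP], ?_, [], ?_⟩
    · simp only [List.map_nil, wP_nil, Equiv.Perm.one_apply]; intro g h1 h2; omega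
    · simp [delW]
  | cons e L ih =>
    obtain ⟨x, y⟩ := e
    simp only [List.map_cons, NR] at ha hb
    obtain ⟨hx, hy⟩ := hL (x, y) (by simp)
    simp only at hx hy
    obtain ⟨hA1, hA2⟩ := List.pairwise_cons.1 hA
    have ih := ih (fun r hr => hL r (by simp [hr])) hA2 ha.2 hb.2
    simp only [List.map_cons, wP_cons, Equiv.Perm.mul_apply]
    rcases ih with ⟨hq, hS⟩ | hD | hD
    · obtain ⟨hS1, hS2, L', h1, h2, h3, h4, h5⟩ := hS
      have hna := ha.1
      have hnb := hb.1
      rw [← hq] at hnb ⊢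
      have hqq := hq
      generalize hqe : wP (L.map Prod.fst) N = q at *
      have hg : ∀ g, q ≤ g → g ≤ N → (x < g ↔ y < g) := by
        intro g hg1 hg2
        rcases Nat.lt_or_ge g N with h | h
        · exact hA1 _ (hS2 g hg1 h)
        · constructor <;> intro _ <;> omega
      have hgq := hg q le_rfl hS1
      by_cases ca : q = x + 1
      · by_cases cb : q = y + 1
        · -- both drop
          left
          have hxy : x = y := by omega
          subst hxy
          refine ⟨rfl, ?_⟩
          have hE : EGs x q = x := by rw [EGs_apply, if_neg (by omega), if_pos ca]
          rw [hE]
          refine ⟨by omega, ?_, L', ?_, ?_, h3, ?_, ?_⟩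
          · intro g hg1 hg2
            by_cases hgx : g = x
            · simp [hgx]
            · exact List.mem_cons_of_mem _ (hS2 g (by omega) hg2)
          · simp only [List.map_cons, delW]
            rw [if_pos (by omega), h1]
          · simp only [List.map_cons, delW]
            rw [if_pos (by omega), h2]
          · intro r' hr'
            obtain ⟨r, hr, Q, hQ1, hQ2, hQ3, hQ4⟩ := h4 r' hr'
            refine ⟨r, by simp [hr], Q, by omega, hQ2, ?_, hQ4⟩
            intro g hg1 hg2
            by_cases hgx : g = x
            · subst hgx; exact hA1 r hr
            · exact hQ3 g (by omega) hg2
          · intro h; simp [h5 h]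
        · -- a drops, b does not
          right; right
          have hE : EGs x q = x := by rw [EGs_apply, if_neg (by omega), if_pos ca]
          have hE2 : EGs y q = q := by rw [EGs_apply, if_neg (by omega), if_neg cb]
          rw [hE, hE2]
          refine ⟨by omega, hS1, ?_, ?_⟩
          · intro g hg1 hg2
            exact ⟨(y, x), by simp, by simp only; omega, by simp only; omega⟩
          · rcases Nat.lt_or_ge q N with h | h
            · right
              have := hS2 q le_rfl h
              exact List.mem_cons_of_mem _ (List.mem_map.2 ⟨_, this, rfl⟩)
            · left; omega
      · have hE2 : EGs x q = q := by rw [EGs_apply, if_neg (by omega), if_neg ca]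
        by_cases cb : q = y + 1
        · right; left
          have hE : EGs y q = y := by rw [EGs_apply, if_neg (by omega), if_pos cb]
          rw [hE, hE2]
          refine ⟨by omega, hS1, ?_, ?_⟩
          · intro g hg1 hg2
            exact ⟨(x, y), by simp, by simp only; omega, by simp only; omega⟩
          · rcases Nat.lt_or_ge q N with h | h
            · right
              exact List.mem_cons_of_mem _ (hS2 q le_rfl h)
            · left; omega
        · left
          have hE : EGs y q = q := by rw [EGs_apply, if_neg (by omega), if_neg cb]
          rw [hE, hE2]
          refine ⟨rfl, hS1, fun g hg1 hg2 => List.mem_cons_of_mem _ (hS2 g hg1 hg2), ?_⟩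
          have hold : ∀ r' ∈ L', ∃ r ∈ (x, y) :: L, PInv N q r' r := by
            intro r' hr'
            obtain ⟨r, hr, hh⟩ := h4 r' hr'
            exact ⟨r, by simp [hr], hh⟩
          by_cases hs : q < x
          · refine ⟨(x - 1, y - 1) :: L', ?_, ?_, ?_, ?_, ?_⟩
            · simp only [List.map_cons, delW]
              rw [hqe, if_neg (by omega), if_neg (by omega), if_pos hs, h1]
            · simp only [List.map_cons, delW]
              rw [← hqq, if_neg (by omega), if_neg (by omega), if_pos (by omega), h2]
            · refine List.pairwise_cons.2 ⟨?_, h3⟩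
              intro r' hr'
              obtain ⟨r, hr, Q, hQ1, hQ2, hQ3, hQ4⟩ := h4 r' hr'
              have hAr := hA1 r hr
              simp only [Asc] at hAr ⊢
              rcases hQ4 with hQ4 | hQ4
              · constructor
                · intro hlt
                  by_contra hcon
                  have hv : x = r.1 := by omega
                  have e1 := hQ3 (x - 1) (by omega) (by omega)
                  have e2 := hg (x + 1) (by omega) (by omega)
                  omega
                · intro hlt
                  by_contra hcon
                  have hv : y = r.2 := by omega
                  have e1 := hQ3 (y - 1) (by omega) (by omega)
                  have e2 := hg (y + 1) (by omega) (by omega)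
                  omega
              · omega
            · intro r' hr'
              rcases List.mem_cons.1 hr' with rfl | hr'
              · refine ⟨(x, y), by simp, q, le_rfl, hS1, fun g _ _ => by omega, Or.inr ?_⟩
                simp only; omega
              · exact hold r' hr'
            · intro h
              simp only [List.map_cons, List.cons.injEq] at h ⊢
              exact ⟨by omega, h5 h.2⟩
          · refine ⟨(x, y) :: L', ?_, ?_, ?_, ?_, ?_⟩
            · simp only [List.map_cons, delW]
              rw [hqe, if_neg (by omega), if_neg (by omega), if_neg hs, h1]
            · simp only [List.map_cons, delW]
              rw [← hqq, if_neg (by omega), if_neg (by omega), if_neg (by omega), h2]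
            · refine List.pairwise_cons.2 ⟨?_, h3⟩
              intro r' hr'
              obtain ⟨r, hr, Q, hQ1, hQ2, hQ3, hQ4⟩ := h4 r' hr'
              have hAr := hA1 r hr
              simp only [Asc] at hAr ⊢
              omega
            · intro r' hr'
              rcases List.mem_cons.1 hr' with rfl | hr'
              · refine ⟨(x, y), by simp, q, le_rfl, hS1, fun g _ _ => by omega, Or.inl ?_⟩
                simp only [true_and]; omega
              · exact hold r' hr'
            · intro h
              simp only [List.map_cons, List.cons.injEq] at h ⊢
              exact ⟨by omega, h5 h.2⟩
    · right; left
      exact hD.step hA1 hy ha.1 hb.1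
    · right; right
      refine hD.step (x := y) (y := x) ?_ hx hb.1 ha.1
      intro r hr
      obtain ⟨s, hs, rfl⟩ := List.mem_map.1 hr
      exact (hA1 s hs).symm

theorem word_inj (N : ℕ) : ∀ (L : List (ℕ × ℕ)), (∀ r ∈ L, r.1 < N ∧ r.2 < N) →
    L.Pairwise Asc → MinW (L.map Prod.fst) → MinW (L.map Prod.snd) →
    wP (L.map Prod.fst) = wP (L.map Prod.snd) → L.map Prod.fst = L.map Prod.snd := by
  induction N with
  | zero =>
    intro L hL _ _ _ _
    cases L with
    | nil => rfl
    | cons e L => exact absurd (hL e (by simp)).1 (by omega)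
  | succ N ih =>
    intro L hL hA ha hb hw
    have la : ∀ x ∈ L.map Prod.fst, x < N + 1 := by
      intro x hx
      obtain ⟨r, hr, rfl⟩ := List.mem_map.1 hx
      exact (hL r hr).1
    have lb : ∀ x ∈ L.map Prod.snd, x < N + 1 := by
      intro x hx
      obtain ⟨r, hr, rfl⟩ := List.mem_map.1 hx
      exact (hL r hr).2
    rcases trich (N + 1) L hL hA (ha.nr la) (hb.nr lb) with ⟨hq, hS⟩ | hD | hD
    · obtain ⟨-, -, L', h1, h2, h3, -, h5⟩ := hS
      apply h5
      have da := delW_lt N _ la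
      have db := delW_lt N _ lb
      rw [← h1] at da
      rw [← h2] at db
      apply ih L' _ h3
      · rw [h1]; exact ha.del la
      · rw [h2]; exact hb.del lb
      · rw [h1, h2]
        have e1 := delW_prod (N + 1) _ la
        have e2 := delW_prod (N + 1) _ lb
        rw [← hq, ← hw] at e2
        exact mul_left_cancel (e1.symm.trans e2)
      · intro r hr
        exact ⟨da _ (List.mem_map.2 ⟨r, hr, rfl⟩), db _ (List.mem_map.2 ⟨r, hr, rfl⟩)⟩
    · have := hD.1
      rw [hw] at this
      omega
    · have := hD.1
      rw [hw] at this
      omega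

theorem IsReducedWord.minW {w : Equiv.Perm ℕ} {l : List ℕ} (h : IsReducedWord w l) : MinW l := by
  intro l2 h2
  rw [h.2]
  exact Nat.sInf_le ⟨l2, h2.trans h.1, rfl⟩

/-! ### Tableaux -/

/-- Cells in reading order. -/
def cellList (μ : YoungDiagram) : List (ℕ × ℕ) :=
  (List.range (μ.colLen 0)).flatMap fun i =>
    ((List.range (μ.rowLen i)).reverse).map fun j => (i, j)

theorem readingWord_eq (μ : YoungDiagram) (T : ℕ → ℕ → ℕ) :
    readingWord μ T = (cellList μ).map fun c => T c.1 c.2 := by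
  simp [readingWord, cellList, List.map_flatMap, Function.comp_def]

theorem mem_cellList (μ : YoungDiagram) (c : ℕ × ℕ) : c ∈ cellList μ ↔ c ∈ μ := by
  obtain ⟨i, j⟩ := c
  simp only [cellList, List.mem_flatMap, List.mem_range, List.mem_map, List.mem_reverse,
    Prod.mk.injEq]
  constructor
  · rintro ⟨a, _, b, hb, rfl, rfl⟩
    exact YoungDiagram.mem_iff_lt_rowLen.2 hb
  · intro h
    refine ⟨i, ?_, j, YoungDiagram.mem_iff_lt_rowLen.1 h, rfl, rfl⟩
    exact YoungDiagram.mem_iff_lt_colLen.1 (μ.up_left_mem le_rfl (Nat.zero_le _) h)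

theorem cellList_pairwise (μ : YoungDiagram) :
    (cellList μ).Pairwise fun c d => c.1 < d.1 ∨ (c.1 = d.1 ∧ d.2 < c.2) := by
  unfold cellList
  rw [List.pairwise_flatMap]
  refine ⟨fun i _ => ?_, ?_⟩
  · rw [List.pairwise_map, List.pairwise_reverse]
    exact List.pairwise_lt_range.imp (fun h => Or.inr ⟨rfl, h⟩)
  · refine List.pairwise_lt_range.imp ?_
    intro a b hab c hc d hd
    obtain ⟨_, _, rfl⟩ := List.mem_map.1 hc
    obtain ⟨_, _, rfl⟩ := List.mem_map.1 hd
    exact Or.inl hab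

/-- Weak order used for standardization. -/
def kle (T : ℕ → ℕ → ℕ) (c d : ℕ × ℕ) : Prop :=
  T c.1 c.2 < T d.1 d.2 ∨ (T c.1 c.2 = T d.1 d.2 ∧ c.2 < d.2) ∨
        (T c.1 c.2 = T d.1 d.2 ∧ c.2 = d.2 ∧ c.1 ≤ d.1)

theorem std_lt (μ : YoungDiagram) (T : ℕ → ℕ → ℕ) (c d : ℕ × ℕ) (hc : c ∈ μ.cells)
    (hd : d ∈ μ.cells) (h : ¬ kle T d c) : stdEntry μ T c.1 c.2 < stdEntry μ T d.1 d.2 := by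
  unfold stdEntry
  rw [if_pos (by simpa using hc), if_pos (by simpa using hd)]
  apply Finset.card_lt_card
  rw [Finset.ssubset_iff_of_subset]
  · refine ⟨d, ?_, ?_⟩
    · simp only [Finset.mem_filter]; exact ⟨hd, Or.inr (Or.inr ⟨trivial, trivial, le_rfl⟩)⟩
    · simp only [Finset.mem_filter, not_and]; exact fun _ => h
  · intro e he
    simp only [Finset.mem_filter] at he ⊢
    refine ⟨he.1, ?_⟩
    have := he.2
    unfold kle at h
    omega

theorem std_inj (μ : YoungDiagram) (T : ℕ → ℕ → ℕ) (c d : ℕ × ℕ) (hc : c ∈ μ.cells)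
    (hd : d ∈ μ.cells) (h : stdEntry μ T c.1 c.2 = stdEntry μ T d.1 d.2) : c = d := by
  by_cases h1 : kle T d c
  · by_cases h2 : kle T c d
    · unfold kle at h1 h2
      ext <;> omega
    · have := std_lt μ T d c hd hc h2; omega
  · have := std_lt μ T c d hc hd h1; omega

theorem std_mem (μ : YoungDiagram) (T : ℕ → ℕ → ℕ)
    (h1 : ∀ i j1 j2, j1 < j2 → (i, j2) ∈ μ.cells → T i j1 < T i j2)
    (h2 : ∀ i1 i2 j, i1 < i2 → (i2, j) ∈ μ.cells → T i1 j < T i2 j) :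
    stdEntry μ T ∈ SYTset μ := by
  refine ⟨?_, ?_, ?_, ?_⟩
  · intro i j1 j2 hj hm
    have hm' : (i, j1) ∈ μ.cells := μ.up_left_mem le_rfl hj.le hm
    have := h1 i j1 j2 hj hm
    exact std_lt μ T (i, j1) (i, j2) hm' hm (by unfold kle; simp only; omega)
  · intro i1 i2 j hi hm
    have hm' : (i1, j) ∈ μ.cells := μ.up_left_mem hi.le le_rfl hm
    have := h2 i1 i2 j hi hm
    exact std_lt μ T (i1, j) (i2, j) hm' hm (by unfold kle; simp only; omega)
  · intro i j h
    unfold stdEntry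
    rw [if_neg h]
  · apply Finset.eq_of_subset_of_card_le
    · intro n hn
      obtain ⟨c, hc, rfl⟩ := Finset.mem_image.1 hn
      simp only [stdEntry]
      rw [if_pos (by simpa using hc), Finset.mem_Icc]
      refine ⟨Finset.card_pos.2 ⟨c, ?_⟩, Finset.card_filter_le _ _⟩
      simp only [Finset.mem_filter]; exact ⟨hc, Or.inr (Or.inr ⟨trivial, trivial, le_rfl⟩)⟩
    · rw [Finset.card_image_of_injOn (fun c hc d hd h => std_inj μ T c d hc hd h)]
      simp

theorem SYT_finite (μ : YoungDiagram) : (SYTset μ).Finite := by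
  have hf : (Set.univ : Set (μ.cells → Fin (μ.card + 1))).Finite := Set.finite_univ
  refine (hf.image (fun f => fun i j =>
    if h : (i, j) ∈ μ.cells then (f ⟨(i, j), h⟩ : ℕ) else 0)).subset ?_
  rintro U ⟨_, _, h3, h4⟩
  refine ⟨fun c => ⟨U c.1.1 c.1.2, ?_⟩, trivial, ?_⟩
  · have : U c.1.1 c.1.2 ∈ Finset.Icc 1 μ.card := by
      rw [← h4]; exact Finset.mem_image.2 ⟨c.1, c.2, rfl⟩
    rw [Finset.mem_Icc] at this
    omega
  · funext i j
    by_cases h : (i, j) ∈ μ.cells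
    · simp only [dif_pos h]
    · simp only [dif_neg h]; exact (h3 i j h).symm

theorem asc_iff (μ : YoungDiagram) (T : ℕ → ℕ → ℕ)
    (h1 : ∀ i j1 j2, j1 < j2 → (i, j2) ∈ μ.cells → T i j1 < T i j2)
    (h2 : ∀ i1 i2 j, i1 < i2 → (i2, j) ∈ μ.cells → T i1 j < T i2 j)
    (c d : ℕ × ℕ) (hc : c ∈ μ.cells) (hd : d ∈ μ.cells)
    (hcd : c.1 < d.1 ∨ (c.1 = d.1 ∧ d.2 < c.2)) :
    T c.1 c.2 < T d.1 d.2 ↔ stdEntry μ T c.1 c.2 < stdEntry μ T d.1 d.2 := by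
  obtain ⟨i, j⟩ := c
  obtain ⟨k, l⟩ := d
  simp only at hcd ⊢
  constructor
  · intro h
    exact std_lt μ T (i, j) (k, l) hc hd (by unfold kle; simp only; omega)
  · intro h
    by_contra hcon
    have hk : ¬ kle T (i, j) (k, l) := by
      unfold kle
      simp only
      rcases hcd with hik | ⟨rfl, hlj⟩
      · rcases Nat.lt_or_ge l j with hlj | hlj
        · omega
        · have e1 := h2 i k l hik hd
          have e2 : T i j ≤ T i l := by
            rcases hlj.eq_or_lt with rfl | hlj
            · exact le_rfl
            · exact (h1 i j l hlj (μ.up_left_mem hik.le le_rfl hd)).le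
          omega
      · have := h1 i l j hlj hc
        omega
    have := std_lt μ T (k, l) (i, j) hd hc hk
    simp only at this
    omega

theorem std_injOn (μ : YoungDiagram) (w : Equiv.Perm ℕ) :
    Set.InjOn (stdEntry μ) (EGset μ w) := by
  rintro T ⟨h1, h2, h3, h4⟩ T' ⟨h1', h2', h3', h4'⟩ hs
  let L : List (ℕ × ℕ) := (cellList μ).map fun c => (T c.1 c.2, T' c.1 c.2)
  have ea : L.map Prod.fst = readingWord μ T := by
    rw [readingWord_eq]; simp [L, Function.comp_def]
  have eb : L.map Prod.snd = readingWord μ T' := by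
    rw [readingWord_eq]; simp [L, Function.comp_def]
  have key : L.map Prod.fst = L.map Prod.snd := by
    apply word_inj ((L.map Prod.fst).sum + (L.map Prod.snd).sum + 1) L
    · intro r hr
      have e1 := List.le_sum_of_mem (List.mem_map.2 ⟨r, hr, rfl⟩ : r.1 ∈ L.map Prod.fst)
      have e2 := List.le_sum_of_mem (List.mem_map.2 ⟨r, hr, rfl⟩ : r.2 ∈ L.map Prod.snd)
      omega
    · rw [List.pairwise_map]
      refine (cellList_pairwise μ).imp_of_mem ?_
      intro c d hc hd hcd
      rw [mem_cellList] at hc hd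
      unfold Asc
      simp only
      rw [asc_iff μ T h1 h2 c d hc hd hcd, asc_iff μ T' h1' h2' c d hc hd hcd, hs]
    · rw [ea]; exact h4.minW
    · rw [eb]; exact h4'.minW
    · rw [ea, eb]; exact h4.1.trans h4'.1.symm
  rw [ea, eb, readingWord_eq, readingWord_eq, List.map_inj_left] at key
  funext i j
  by_cases h : (i, j) ∈ μ.cells
  · exact key (i, j) ((mem_cellList μ _).2 h)
  · rw [h3 i j h, h3' i j h]

/-- `a_{w,λ} ≤ f^λ`. -/
theorem stmt8 (μ : YoungDiagram) (w : Equiv.Perm ℕ) :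
    (EGset μ w).ncard ≤ (SYTset μ).ncard := by
  exact Set.ncard_le_ncard_of_injOn (stdEntry μ)
    (fun T hT => std_mem μ T hT.1 hT.2.1) (std_injOn μ w) (SYT_finite μ)
end
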